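/- arXiv:2305.13116 — 3 statements merged into one kernel-verified Lean document; each statement's English description precedes it below -/
import Mathlib

section
/- Let 0 < η ≤ ρ < 1 and set b = √((ρ² − η²)/(1 + η²ρ² − 2η²)). Let (Z, X, V) be a centered Gaussian vector with unit variances and E[XZ] = η, E[XV] = b, E[ZV] = ηb. Then E[(E[X | Z, V])²] = ρ². -/
open MeasureTheory ProbabilityTheory Real
open scoped NNReal ENNReal

/-- `(Z, X, V)` is a centered jointly Gaussian vector with unit variances,
`E[XZ] = η`, `E[XV] = b`, `E[ZV] = ηb`: every linear combination is Gaussian with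
the variance given by the quadratic form of the covariance matrix. -/
def IsCenteredGaussianTriple {Ω : Type*} [MeasurableSpace Ω] (μ : Measure Ω)
    (Z X V : Ω → ℝ) (η b : ℝ) : Prop :=
  ∀ a c e : ℝ,
    μ.map (fun ω => a * Z ω + c * X ω + e * V ω) =
      gaussianReal 0
        (Real.toNNReal
          (a ^ 2 + c ^ 2 + e ^ 2 + 2 * a * c * η + 2 * c * e * b + 2 * a * e * (η * b)))

/-- For `0 < η ≤ ρ < 1` and `b = √((ρ² − η²)/(1 + η²ρ² − 2η²))`, the centered Gaussian
vector `(Z, X, V)` with unit variances, `E[XZ] = η`, `E[XV] = b`, `E[ZV] = ηb` satisfies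
`E[(E[X | Z, V])²] = ρ²`. -/
theorem gaussian_secondMoment_condExp
    {Ω : Type*} [MeasurableSpace Ω] (μ : Measure Ω) [IsProbabilityMeasure μ]
    (Z X V : Ω → ℝ) (hZ : Measurable Z) (hX : Measurable X) (hV : Measurable V)
    (η ρ b : ℝ) (hη : 0 < η) (hηρ : η ≤ ρ) (hρ : ρ < 1)
    (hbdef : b = Real.sqrt ((ρ ^ 2 - η ^ 2) / (1 + η ^ 2 * ρ ^ 2 - 2 * η ^ 2)))
    (hG : IsCenteredGaussianTriple μ Z X V η b) :
    ∫ ω, ((μ[X | MeasurableSpace.comap (fun ω => (Z ω, V ω)) inferInstance]) ω) ^ 2 ∂μ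
      = ρ ^ 2 := by
  have hη1 : η < 1 := lt_of_le_of_lt hηρ hρ
  have hηs : η ^ 2 < 1 := by nlinarith
  have hρs : ρ ^ 2 < 1 := by nlinarith
  have hηρs : η ^ 2 ≤ ρ ^ 2 := by nlinarith
  have hD : 0 < 1 + η ^ 2 * ρ ^ 2 - 2 * η ^ 2 := by
    nlinarith [mul_nonneg (sq_nonneg η) (sub_nonneg.2 hηρs), pow_pos (sub_pos.2 hηs) 2]
  have hb2 : b ^ 2 = (ρ ^ 2 - η ^ 2) / (1 + η ^ 2 * ρ ^ 2 - 2 * η ^ 2) := by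
    rw [hbdef, Real.sq_sqrt (div_nonneg (sub_nonneg.2 hηρs) hD.le)]
  have hb3 : b ^ 2 * (1 + η ^ 2 * ρ ^ 2 - 2 * η ^ 2) = ρ ^ 2 - η ^ 2 := by
    rw [hb2, div_mul_cancel₀ _ hD.ne.symm]
  have hb1 : b ^ 2 ≤ 1 := by
    rw [hb2, div_le_one hD]
    nlinarith [mul_pos (sub_pos.2 hηs) (sub_pos.2 hρs)]
  have hK : 0 < 1 - η ^ 2 * b ^ 2 := by nlinarith [sq_nonneg b, sq_nonneg η]
  have hq : ∀ a c e : ℝ, 0 ≤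
      a ^ 2 + c ^ 2 + e ^ 2 + 2 * a * c * η + 2 * c * e * b + 2 * a * e * (η * b) := by
    intro a c e
    nlinarith [sq_nonneg (c + η * a + b * e), mul_nonneg (sub_nonneg.2 hηs.le) (sq_nonneg a),
      mul_nonneg (sub_nonneg.2 hb1) (sq_nonneg e)]
  have hL2 : ∀ a c e : ℝ, MemLp (fun ω => a * Z ω + c * X ω + e * V ω) 2 μ := by
    intro a c e
    have hm : Measurable (fun ω => a * Z ω + c * X ω + e * V ω) := by fun_prop
    have h := memLp_id_gaussianReal' (μ := 0) (v := Real.toNNReal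
          (a ^ 2 + c ^ 2 + e ^ 2 + 2 * a * c * η + 2 * c * e * b + 2 * a * e * (η * b)))
          2 (by simp)
    rw [← hG a c e] at h
    exact h.comp_of_map hm.aemeasurable
  have hmean : ∀ a c e : ℝ, ∫ ω, (a * Z ω + c * X ω + e * V ω) ∂μ = 0 := by
    intro a c e
    have hm : Measurable (fun ω => a * Z ω + c * X ω + e * V ω) := by fun_prop
    have h := integral_map (μ := μ) hm.aemeasurable (f := fun x : ℝ => x) (by fun_prop)
    rw [← h, hG a c e, integral_id_gaussianReal]
  have hsq : ∀ a c e : ℝ, ∫ ω, (a * Z ω + c * X ω + e * V ω) ^ 2 ∂μ =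
      a ^ 2 + c ^ 2 + e ^ 2 + 2 * a * c * η + 2 * c * e * b + 2 * a * e * (η * b) := by
    intro a c e
    have hm : Measurable (fun ω => a * Z ω + c * X ω + e * V ω) := by fun_prop
    have h := integral_map (μ := μ) hm.aemeasurable (f := fun x : ℝ => x ^ 2) (by fun_prop)
    have h2 := variance_fun_id_gaussianReal (μ := 0) (v := Real.toNNReal
          (a ^ 2 + c ^ 2 + e ^ 2 + 2 * a * c * η + 2 * c * e * b + 2 * a * e * (η * b)))
    rw [variance_eq_integral measurable_id'.aemeasurable, integral_id_gaussianReal] at h2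
    simp only [sub_zero] at h2
    rw [← h, hG a c e, h2, Real.coe_toNNReal _ (hq a c e)]
  have hchar : ∀ a c e : ℝ, ∫ ω, Complex.exp (((a * Z ω + c * X ω + e * V ω : ℝ) : ℂ) *
      Complex.I) ∂μ = Complex.exp (((-(a ^ 2 + c ^ 2 + e ^ 2 + 2 * a * c * η + 2 * c * e * b
        + 2 * a * e * (η * b)) / 2 : ℝ) : ℂ)) := by
    intro a c e
    have hm : Measurable (fun ω => a * Z ω + c * X ω + e * V ω) := by fun_prop
    have h := integral_map (μ := μ) hm.aemeasurable
      (f := fun x : ℝ => Complex.exp ((x : ℂ) * Complex.I)) (by fun_prop)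
    have h2 := charFun_gaussianReal (μ := 0) (v := Real.toNNReal
          (a ^ 2 + c ^ 2 + e ^ 2 + 2 * a * c * η + 2 * c * e * b + 2 * a * e * (η * b))) 1
    rw [charFun_apply_real] at h2
    simp only [Complex.ofReal_one, one_mul] at h2
    have h3 : (((Real.toNNReal
          (a ^ 2 + c ^ 2 + e ^ 2 + 2 * a * c * η + 2 * c * e * b + 2 * a * e * (η * b))) : ℝ) : ℂ)
        = ((a ^ 2 + c ^ 2 + e ^ 2 + 2 * a * c * η + 2 * c * e * b + 2 * a * e * (η * b) : ℝ) : ℂ) :=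
      by rw [Real.coe_toNNReal _ (hq a c e)]
    rw [h3] at h2
    rw [← h, hG a c e, h2]
    congr 1
    push_cast
    ring
  obtain ⟨α, hα⟩ : ∃ α, α = η * (1 - b ^ 2) / (1 - η ^ 2 * b ^ 2) := ⟨_, rfl⟩
  obtain ⟨β, hβ⟩ : ∃ β, β = b * (1 - η ^ 2) / (1 - η ^ 2 * b ^ 2) := ⟨_, rfl⟩
  -- normal equations
  have hN1 : α + β * (η * b) = η := by
    rw [hα, hβ]; field_simp; ring
  have hN2 : α * (η * b) + β = b := by
    rw [hα, hβ]; field_simp; ring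
  have hfin : α * η + β * b = ρ ^ 2 := by
    rw [hα, hβ]; field_simp; linear_combination hb3
  obtain ⟨W, hW⟩ : ∃ W : Ω → ℝ, W = fun ω => X ω - (α * Z ω + β * V ω) := ⟨_, rfl⟩
  have hWm : Measurable W := by rw [hW]; fun_prop
  have hYm : Measurable (fun ω => (Z ω, V ω)) := hZ.prodMk hV
  have hindep : IndepFun W (fun ω => (Z ω, V ω)) μ := by
    rw [indepFun_iff_charFunDual_prod hWm.aemeasurable hYm.aemeasurable]
    intro L
    obtain ⟨l, hl⟩ : ∃ l, l = L (1, (0, 0)) := ⟨_, rfl⟩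
    obtain ⟨s, hs⟩ : ∃ s, s = L (0, (1, 0)) := ⟨_, rfl⟩
    obtain ⟨t, ht⟩ : ∃ t, t = L (0, (0, 1)) := ⟨_, rfl⟩
    have hLf : ∀ w z v : ℝ, L (w, (z, v)) = l * w + s * z + t * v := by
      intro w z v
      have : ((w, (z, v)) : ℝ × ℝ × ℝ) = w • (1, (0, 0)) + z • (0, (1, 0)) + v • (0, (0, 1)) := by
        simp
      rw [this, map_add, map_add, map_smul, map_smul, map_smul, hl, hs, ht]
      simp only [smul_eq_mul]; ring
    rw [charFunDual_apply, charFunDual_apply, charFunDual_apply,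
      integral_map (hWm.prodMk hYm).aemeasurable (by fun_prop),
      integral_map hWm.aemeasurable (by fun_prop),
      integral_map hYm.aemeasurable (by fun_prop)]
    simp only [ContinuousLinearMap.comp_apply, ContinuousLinearMap.inl_apply,
      ContinuousLinearMap.inr_apply]
    have e1 := hchar (s - l * α) l (t - l * β)
    have e2 := hchar (- l * α) l (- l * β)
    have e3 := hchar s 0 t
    have f1 : ∀ ω, L (W ω, (Z ω, V ω)) = (s - l * α) * Z ω + l * X ω + (t - l * β) * V ω := by
      intro ω; rw [hLf, hW]; ring
    have f2 : ∀ ω, L (W ω, 0) = (- l * α) * Z ω + l * X ω + (- l * β) * V ω := by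
      intro ω
      have : L (W ω, 0) = L (W ω, (0, 0)) := rfl
      rw [this, hLf, hW]; ring
    have f3 : ∀ ω, L (0, (Z ω, V ω)) = s * Z ω + 0 * X ω + t * V ω := by
      intro ω; rw [hLf]; ring
    simp only [f1, f2, f3]
    rw [e1, e2, e3, ← Complex.exp_add, ← Complex.ofReal_add]
    congr 2
    linear_combination s * l * hN1 + t * l * hN2
  have hle : MeasurableSpace.comap (fun ω => (Z ω, V ω)) inferInstance ≤ ‹MeasurableSpace Ω› :=
    hYm.comap_le
  have hWint : ∫ ω, W ω ∂μ = 0 := by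
    rw [← hmean (-α) 1 (-β), hW]; congr 1; ext ω; ring
  have hWi : Integrable W μ := by
    have := (hL2 (-α) 1 (-β)).integrable (by norm_num)
    convert this using 1
    rw [hW]; ext ω; ring
  have hYi : Integrable (fun ω => α * Z ω + β * V ω) μ := by
    have := (hL2 α 0 β).integrable (by norm_num)
    convert this using 1
    ext ω; ring
  have hcW := condExp_indep_eq (μ := μ) hWm.comap_le hle
    (comap_measurable W).stronglyMeasurable hindep
  have hcY : μ[(fun ω => α * Z ω + β * V ω) |
      MeasurableSpace.comap (fun ω => (Z ω, V ω)) inferInstance] =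
      fun ω => α * Z ω + β * V ω := by
    refine condExp_of_stronglyMeasurable hle (Measurable.stronglyMeasurable ?_) hYi
    have hg : Measurable (fun p : ℝ × ℝ => α * p.1 + β * p.2) := by fun_prop
    exact hg.comp (comap_measurable (fun ω => (Z ω, V ω)))
  have hXe : X = W + fun ω => α * Z ω + β * V ω := by
    rw [hW]; ext ω; simp
  have hcX : μ[X | MeasurableSpace.comap (fun ω => (Z ω, V ω)) inferInstance] =ᵐ[μ]
      fun ω => α * Z ω + 0 * X ω + β * V ω := by
    have h := condExp_add hWi hYi (MeasurableSpace.comap (fun ω => (Z ω, V ω)) inferInstance)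
    rw [← hXe, hcY] at h
    filter_upwards [h, hcW] with ω h1 h2
    rw [h1, Pi.add_apply, h2, hWint]; ring
  have hfe : ∫ ω, ((μ[X | MeasurableSpace.comap (fun ω => (Z ω, V ω)) inferInstance]) ω) ^ 2 ∂μ
      = ∫ ω, (α * Z ω + 0 * X ω + β * V ω) ^ 2 ∂μ := by
    apply integral_congr_ae
    filter_upwards [hcX] with ω h
    rw [h]
  rw [hfe, hsq]
  linear_combination α * hN1 + β * hN2 + hfin
end

section
/- Let 0 < η ≤ ρ < 1, b = √((ρ²−η²)/(1+η²ρ²−2η²)), (Z, X, V) centered Gaussian with unit variances, E[XZ]=η, E[XV]=b, E[ZV]=ηb, and Y = ρ⁻¹·E[X|Z,V]. Then E[(X − Y)²] = 2(1 − ρ). -/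
open MeasureTheory ProbabilityTheory Real
open scoped NNReal ENNReal

lemma aux_params (η ρ b : ℝ) (hη : 0 < η) (hηρ : η ≤ ρ) (hρ : ρ < 1)
    (hbdef : b = Real.sqrt ((ρ ^ 2 - η ^ 2) / (1 + η ^ 2 * ρ ^ 2 - 2 * η ^ 2))) :
    (η * b) ^ 2 ≤ 1 ∧ ∃ α β : ℝ, α + β * (η * b) = η ∧ α * (η * b) + β = b ∧
      α * η + β * b = ρ ^ 2 := by
  have hη2 : η ^ 2 ≤ ρ ^ 2 := by gcongr
  have hη1 : η ^ 2 < 1 := by nlinarith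
  have hρ1 : ρ ^ 2 < 1 := by nlinarith
  have hD : 0 < 1 + η ^ 2 * ρ ^ 2 - 2 * η ^ 2 := by nlinarith [sq_nonneg η, sq_nonneg (η ^ 2 - 1)]
  have hb2 : b ^ 2 = (ρ ^ 2 - η ^ 2) / (1 + η ^ 2 * ρ ^ 2 - 2 * η ^ 2) := by
    rw [hbdef, Real.sq_sqrt]
    exact div_nonneg (by linarith) hD.le
  have hb1 : b ^ 2 < 1 := by
    rw [hb2, div_lt_one hD]; nlinarith
  have hb3 : b ^ 2 * (1 + η ^ 2 * ρ ^ 2 - 2 * η ^ 2) = ρ ^ 2 - η ^ 2 := by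
    rw [hb2]; exact div_mul_cancel₀ _ hD.ne'
  have hd : 0 < 1 - η ^ 2 * b ^ 2 := by nlinarith [sq_nonneg η, sq_nonneg b]
  refine ⟨by nlinarith, η * (1 - b ^ 2) / (1 - η ^ 2 * b ^ 2),
    b * (1 - η ^ 2) / (1 - η ^ 2 * b ^ 2), ?_, ?_, ?_⟩
  · field_simp; ring
  · field_simp; ring
  · field_simp; linarith

lemma aux_charFun {Ω : Type*} [MeasurableSpace Ω] (μ : Measure Ω)
    (Z X V : Ω → ℝ) (η b : ℝ) (hG : IsCenteredGaussianTriple μ Z X V η b) (a c e Q : ℝ)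
    (f : Ω → ℝ) (hf : ∀ ω, f ω = a * Z ω + c * X ω + e * V ω)
    (hQ : Q = a ^ 2 + c ^ 2 + e ^ 2 + 2 * a * c * η + 2 * c * e * b + 2 * a * e * (η * b))
    (h0 : 0 ≤ Q) :
    charFun (μ.map f) 1 = Complex.exp (((-Q / 2 : ℝ)) : ℂ) := by
  have : f = fun ω => a * Z ω + c * X ω + e * V ω := funext hf
  rw [this, hG a c e, ← hQ, charFun_gaussianReal, Real.coe_toNNReal _ h0]
  congr 1
  push_cast
  ring

lemma aux_memLp {Ω : Type*} [MeasurableSpace Ω] (μ : Measure Ω)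
    (f : Ω → ℝ) (hf : Measurable f) (v : ℝ≥0) (h : μ.map f = gaussianReal 0 v) :
    Integrable f μ ∧ ∫ ω, f ω ∂μ = 0 ∧ ∫ ω, (f ω) ^ 2 ∂μ = v := by
  refine ⟨?_, ?_, ?_⟩
  · have h1 : Integrable id (μ.map f) := by
      rw [h]; exact (memLp_id_gaussianReal 1).integrable (by simp)
    exact h1.comp_measurable hf
  · have : ∫ x, x ∂(μ.map f) = 0 := by rw [h]; simp
    rwa [integral_map hf.aemeasurable (by fun_prop)] at this
  · have h2 : ∫ x, x ^ 2 ∂(μ.map f) = v := by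
      rw [h]
      have := variance_fun_id_gaussianReal (μ := 0) (v := v)
      rw [variance_eq_integral measurable_id'.aemeasurable] at this
      simpa using this
    rwa [integral_map hf.aemeasurable (by fun_prop)] at h2

lemma aux_condExp {Ω E : Type*} [MeasurableSpace Ω] [MeasurableSpace E] (μ : Measure Ω)
    [IsProbabilityMeasure μ] (W X : Ω → ℝ) (T : Ω → E) (g : E → ℝ) (hWm : Measurable W)
    (hT : Measurable T) (hg : Measurable g) (hind : IndepFun W T μ) (hWi : Integrable W μ)
    (hUi : Integrable (fun ω => g (T ω)) μ) (hW0 : ∫ ω, W ω ∂μ = 0)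
    (hX : X = W + fun ω => g (T ω)) :
    μ[X | MeasurableSpace.comap T inferInstance] =ᵐ[μ] fun ω => g (T ω) := by
  have hUm : StronglyMeasurable[MeasurableSpace.comap T inferInstance] (fun ω => g (T ω)) :=
    (hg.comp (comap_measurable T)).stronglyMeasurable
  have hcW : μ[W | MeasurableSpace.comap T inferInstance] =ᵐ[μ] fun _ => μ[W] :=
    condExp_indep_eq hWm.comap_le hT.comap_le (comap_measurable W).stronglyMeasurable hind
  have h4 := condExp_add hWi hUi (MeasurableSpace.comap T inferInstance)
  rw [← hX, condExp_of_stronglyMeasurable hT.comap_le hUm hUi] at h4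
  filter_upwards [h4, hcW] with ω h5 h6
  rw [h5, Pi.add_apply, h6, hW0, zero_add]

/-- With `0 < η ≤ ρ < 1`, `b = √((ρ²−η²)/(1+η²ρ²−2η²))`, `(Z, X, V)` centered Gaussian
with unit variances, `E[XZ]=η`, `E[XV]=b`, `E[ZV]=ηb`, and `Y = ρ⁻¹·E[X|Z,V]`, the
distortion satisfies `E[(X − Y)²] = 2(1 − ρ)`. -/
theorem gaussian_distortion_is_Delta
    {Ω : Type*} [MeasurableSpace Ω] (μ : Measure Ω) [IsProbabilityMeasure μ]
    (Z X V : Ω → ℝ) (hZ : Measurable Z) (hX : Measurable X) (hV : Measurable V)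
    (η ρ b : ℝ) (hη : 0 < η) (hηρ : η ≤ ρ) (hρ : ρ < 1)
    (hbdef : b = Real.sqrt ((ρ ^ 2 - η ^ 2) / (1 + η ^ 2 * ρ ^ 2 - 2 * η ^ 2))) 
    (hG : IsCenteredGaussianTriple μ Z X V η b) :
    ∫ ω, (X ω -
        ρ⁻¹ * (μ[X | MeasurableSpace.comap (fun ω => (Z ω, V ω)) inferInstance]) ω) ^ 2 ∂μ
      = 2 * (1 - ρ) := by
  obtain ⟨hηb, α, β, h1, h2, h3⟩ := aux_params η ρ b hη hηρ hρ hbdef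
  have hρ0 : 0 < ρ := lt_of_lt_of_le hη hηρ
  have hρ1 : ρ ^ 2 < 1 := by nlinarith
  -- the residual
  set W : Ω → ℝ := fun ω => X ω - (α * Z ω + β * V ω) with hW
  have hWm : Measurable W := by fun_prop
  have hZVm : Measurable (fun ω => (Z ω, V ω)) := by fun_prop
  have hQ2 : ∀ q r : ℝ, 0 ≤ q ^ 2 + r ^ 2 + 2 * q * r * (η * b) := by
    intro q r
    nlinarith [sq_nonneg (q + r * (η * b)), mul_nonneg (sq_nonneg r) (sub_nonneg.2 hηb)]
  have hind : IndepFun W (fun ω => (Z ω, V ω)) μ := by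
    rw [indepFun_iff_charFunDual_prod hWm.aemeasurable hZVm.aemeasurable]
    intro L
    obtain ⟨p, hp⟩ : ∃ p, p = L (1, (0, 0)) := ⟨_, rfl⟩
    obtain ⟨q, hq⟩ : ∃ p, p = L (0, (1, 0)) := ⟨_, rfl⟩
    obtain ⟨r, hr⟩ : ∃ p, p = L (0, (0, 1)) := ⟨_, rfl⟩
    have hL : ∀ w z v : ℝ, L (w, (z, v)) = p * w + q * z + r * v := by
      intro w z v
      have : (w, (z, v)) = w • ((1 : ℝ), ((0 : ℝ), (0 : ℝ))) + z • ((0 : ℝ), ((1 : ℝ), (0 : ℝ)))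
          + v • ((0 : ℝ), ((0 : ℝ), (1 : ℝ))) := by simp
      rw [this, map_add, map_add, map_smul, map_smul, map_smul, ← hp, ← hq, ← hr]
      simp only [smul_eq_mul]; ring
    have hp2 : 0 ≤ p ^ 2 * (1 - ρ ^ 2) := mul_nonneg (sq_nonneg p) (by linarith)
    rw [charFunDual_eq_charFun_map_one, charFunDual_eq_charFun_map_one,
      charFunDual_eq_charFun_map_one, Measure.map_map (by fun_prop) (by fun_prop),
      Measure.map_map (by fun_prop) (by fun_prop), Measure.map_map (by fun_prop) (by fun_prop)]
    have hkey : α ^ 2 + β ^ 2 + 2 * α * β * (η * b) = ρ ^ 2 := by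
      linear_combination α * h1 + β * h2 + h3
    rw [aux_charFun μ Z X V η b hG (q - p * α) p (r - p * β)
        (p ^ 2 * (1 - ρ ^ 2) + (q ^ 2 + r ^ 2 + 2 * q * r * (η * b))) _ ?_ ?_
        (add_nonneg hp2 (hQ2 q r)),
      aux_charFun μ Z X V η b hG (- p * α) p (- p * β)
        (p ^ 2 * (1 - ρ ^ 2)) _ ?_ ?_ hp2,
      aux_charFun μ Z X V η b hG q 0 r
        (q ^ 2 + r ^ 2 + 2 * q * r * (η * b)) _ ?_ ?_ (hQ2 q r), ← Complex.exp_add]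
    · congr 1
      push_cast
      ring
    · intro ω
      simp [hL]
    · ring
    · intro ω
      have := hL (W ω) 0 0
      simp only [Function.comp, ContinuousLinearMap.comp_apply, ContinuousLinearMap.inl_apply]
      change L (W ω, (0, 0)) = _
      rw [this, hW]; ring
    · linear_combination (-p ^ 2) * hkey + 2 * p ^ 2 * h3
    · intro ω
      simp only [Function.comp, hL, hW]; ring
    · linear_combination (-p ^ 2) * hkey + 2 * p ^ 2 * h3 + 2 * p * q * h1 + 2 * p * r * h2
  obtain ⟨hWi, hW0, -⟩ := aux_memLp μ W hWm _
    (by rw [← hG (-α) 1 (-β)]; congr 1; funext ω; simp only [hW]; ring)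
  obtain ⟨hUi, -, -⟩ := aux_memLp μ (fun ω => α * Z ω + β * V ω) (by fun_prop) _
    (by rw [← hG α 0 β]; congr 1; funext ω; ring)
  have hXeq : X = W + fun ω => α * Z ω + β * V ω := by
    funext ω; simp [hW]
  have hc : μ[X | MeasurableSpace.comap (fun ω => (Z ω, V ω)) inferInstance] =ᵐ[μ]
      fun ω => α * Z ω + β * V ω :=
    aux_condExp μ W X (fun ω => (Z ω, V ω)) (fun x => α * x.1 + β * x.2) hWm hZVm
      (by fun_prop) hind hWi hUi hW0 hXeq
  have hfin : ∫ ω, (X ω - ρ⁻¹ * (μ[X | MeasurableSpace.comap (fun ω => (Z ω, V ω)) inferInstance]) ω) ^ 2 ∂μ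
      = ∫ ω, (-(ρ⁻¹ * α) * Z ω + 1 * X ω + -(ρ⁻¹ * β) * V ω) ^ 2 ∂μ := by
    apply integral_congr_ae
    filter_upwards [hc] with ω h
    simp only [h]; ring
  rw [hfin, (aux_memLp μ _ (by fun_prop) _ (hG (-(ρ⁻¹ * α)) 1 (-(ρ⁻¹ * β)))).2.2]
  have hval : (-(ρ⁻¹ * α)) ^ 2 + 1 ^ 2 + (-(ρ⁻¹ * β)) ^ 2 + 2 * (-(ρ⁻¹ * α)) * 1 * η
      + 2 * 1 * (-(ρ⁻¹ * β)) * b + 2 * (-(ρ⁻¹ * α)) * (-(ρ⁻¹ * β)) * (η * b) = 2 * (1 - ρ) := by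
    have hkey : α ^ 2 + β ^ 2 + 2 * α * β * (η * b) = ρ ^ 2 := by
      linear_combination α * h1 + β * h2 + h3
    have hi : ρ⁻¹ * ρ = 1 := inv_mul_cancel₀ hρ0.ne'
    linear_combination ρ⁻¹ ^ 2 * hkey - 2 * ρ⁻¹ * h3 + (ρ⁻¹ * ρ + 1 - 2 * ρ) * hi
  rw [hval, Real.coe_toNNReal _ (by linarith)]
end

section
/- Let 0 < η ≤ ρ < 1, b = √((ρ²−η²)/(1+η²ρ²−2η²)), and (Z, X, V) centered Gaussian with unit variances, E[XZ]=η, E[XV]=b, E[ZV]=ηb. Then I(X; V | Z) = (1/2)·log((1−η²)/(1−ρ²)). -/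
open MeasureTheory ProbabilityTheory
open scoped ENNReal

/-- Mutual information `I(X;Y)` defined as the KL divergence between the joint law and
the product of the marginal laws. -/
noncomputable def mutualInfo {Ω α β : Type*} [MeasurableSpace Ω] [MeasurableSpace α]
    [MeasurableSpace β] (μ : Measure Ω) (X : Ω → α) (Y : Ω → β) : ℝ :=
  ∫ q, Real.log
      (((μ.map fun ω => (X ω, Y ω)).rnDeriv ((μ.map X).prod (μ.map Y)) q).toReal)
    ∂(μ.map fun ω => (X ω, Y ω))

/-- Conditional mutual information `I(X;Y|Z)`, defined as the average over the law of `Z`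
of the KL divergence between the conditional joint law of `(X,Y)` given `Z` and the
product of the conditional marginal laws. -/
noncomputable def condMutualInfo {Ω α β γ : Type*} [MeasurableSpace Ω]
    [MeasurableSpace α] [StandardBorelSpace α] [Nonempty α]
    [MeasurableSpace β] [StandardBorelSpace β] [Nonempty β]
    [MeasurableSpace γ]
    (μ : Measure Ω) [IsFiniteMeasure μ] (X : Ω → α) (Y : Ω → β) (Z : Ω → γ) : ℝ :=
  ∫ z, ∫ q, Real.log
      (((condDistrib (fun ω => (X ω, Y ω)) Z μ z).rnDeriv
          ((condDistrib X Z μ z).prod (condDistrib Y Z μ z)) q).toReal)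
    ∂(condDistrib (fun ω => (X ω, Y ω)) Z μ z) ∂(μ.map Z)

open scoped NNReal

lemma charFunDual_gaussian_aux (v : ℝ≥0) (L : StrongDual ℝ ℝ) :
    charFunDual (gaussianReal 0 v) L = Complex.exp (-(v * (L 1) ^ 2 / 2 : ℝ)) := by
  rw [charFunDual_eq_charFun_map_one, gaussianReal_map_continuousLinearMap, charFun_gaussianReal]
  congr 1
  have : max ((L 1)^2) 0 = (L 1)^2 := max_eq_left (sq_nonneg _)
  simp [this]
  ring

lemma triple_law {Ω : Type*} [MeasurableSpace Ω] (μ : Measure Ω) [IsProbabilityMeasure μ]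
    (Z W U : Ω → ℝ) (hZ : Measurable Z) (hW : Measurable W) (hU : Measurable U)
    (v₁ v₂ v₃ : ℝ≥0)
    (h : ∀ a c e : ℝ, μ.map (fun ω => a * Z ω + c * W ω + e * U ω) =
      gaussianReal 0 (Real.toNNReal (a ^ 2 * v₁ + c ^ 2 * v₂ + e ^ 2 * v₃))) :
    μ.map (fun ω => (Z ω, (W ω, U ω))) =
      (gaussianReal 0 v₁).prod ((gaussianReal 0 v₂).prod (gaussianReal 0 v₃)) := by
  have hm : Measurable (fun ω => (Z ω, (W ω, U ω))) := by fun_prop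
  have : IsProbabilityMeasure (μ.map (fun ω => (Z ω, (W ω, U ω)))) :=
    Measure.isProbabilityMeasure_map hm.aemeasurable
  apply Measure.ext_of_charFunDual
  ext L
  rw [charFunDual_prod, charFunDual_prod, charFunDual_gaussian_aux, charFunDual_gaussian_aux,
    charFunDual_gaussian_aux, charFunDual_eq_charFun_map_one,
    Measure.map_map (by fun_prop) hm]
  have e1 : (L ∘ fun ω => (Z ω, (W ω, U ω))) = fun ω => L (1, (0, 0)) * Z ω
      + L (0, (1, 0)) * W ω + L (0, (0, 1)) * U ω := by
    ext ω
    have : (Z ω, (W ω, U ω)) = Z ω • ((1, (0, 0)) : ℝ × ℝ × ℝ) + W ω • ((0, (1, 0)) : ℝ × ℝ × ℝ)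
      + U ω • ((0, (0, 1)) : ℝ × ℝ × ℝ) := by simp
    rw [Function.comp_apply, this, map_add, map_add, map_smul, map_smul, map_smul]
    simp only [smul_eq_mul]
    ring
  rw [e1, h, charFun_gaussianReal, ← Complex.exp_add, ← Complex.exp_add]
  congr 1
  rw [Real.coe_toNNReal _ (by positivity)]
  have z0 : ((0, 0) : ℝ × ℝ) = 0 := rfl
  simp [z0]
  ring

lemma condDistrib_indep_aux {Ω α β γ : Type*} [MeasurableSpace Ω] [MeasurableSpace α]
    [MeasurableSpace β] [MeasurableSpace γ] [StandardBorelSpace γ] [Nonempty γ]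
    (μ : Measure Ω) [IsProbabilityMeasure μ] (Z : Ω → α) (Y : Ω → β)
    (hZ : Measurable Z) (hY : Measurable Y) (ν : Measure β) [IsProbabilityMeasure ν]
    (h : μ.map (fun ω => (Z ω, Y ω)) = (μ.map Z).prod ν)
    (f : α × β → γ) (hf : Measurable f) (T : Ω → γ) (hT : T = fun ω => f (Z ω, Y ω)) :
    ∀ᵐ z ∂(μ.map Z), condDistrib T Z μ z = ν.map (fun y => f (z, y)) := by
  subst hT
  let κ : Kernel α γ := Kernel.map (Kernel.id ×ₖ Kernel.const α ν) f
  have hκ : IsMarkovKernel κ := Kernel.IsMarkovKernel.map _ hf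
  have hκz : ∀ z, κ z = ν.map (fun y => f (z, y)) := by
    intro z
    simp only [κ]
    rw [Kernel.map_apply _ hf, Kernel.prod_apply, Kernel.id_apply, Kernel.const_apply,
      Measure.dirac_prod, Measure.map_map hf (by fun_prop)]
    rfl
  have := condDistrib_ae_eq_of_measure_eq_compProd (μ := μ) Z (Y := fun ω => f (Z ω, Y ω))
    (by fun_prop) (κ := κ) ?_
  · filter_upwards [this] with z hz
    rw [hz, hκz]
  · ext S hS
    have hg : Measurable (fun p : α × β => (p.1, f p)) := by fun_prop
    rw [Measure.compProd_apply hS]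
    have : (fun x => (Z x, f (Z x, Y x))) = (fun p : α × β => (p.1, f p)) ∘
      (fun ω => (Z ω, Y ω)) := rfl
    rw [this, ← Measure.map_map hg (by fun_prop), h, Measure.map_apply hg hS,
      Measure.prod_apply (hg hS)]
    congr 1
    ext z
    rw [hκz, Measure.map_apply (by fun_prop) (hS.preimage (by fun_prop))]
    rfl

lemma marginal_aux (σ τ s : ℝ≥0) (k m₁ : ℝ) (h : (σ : ℝ) = k ^ 2 * s + τ) :
    ((gaussianReal 0 τ).prod (gaussianReal 0 s)).map (fun y => m₁ + (k * y.2 + y.1))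
      = gaussianReal m₁ σ := by
  have h1 : (fun y : ℝ × ℝ => m₁ + (k * y.2 + y.1)) =
      (fun x => m₁ + x) ∘ ((fun p : ℝ × ℝ => p.1 + p.2) ∘ (Prod.map id (fun x => k * x))) := by
    ext y; simp; ring
  rw [h1, ← Measure.map_map (by fun_prop) (by fun_prop), ← Measure.map_map (by fun_prop) (by fun_prop),
    ← Measure.map_prod_map _ _ (by fun_prop) (by fun_prop), Measure.map_id, gaussianReal_map_const_mul]
  have := gaussianReal_conv_gaussianReal (m₁ := 0) (v₁ := τ) (m₂ := k * 0) (v₂ := NNReal.mk (k ^ 2) (sq_nonneg _) * s)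
  rw [Measure.conv] at this
  rw [this, gaussianReal_map_const_add]
  congr 1
  · ring
  · ext; push_cast; rw [h]; ring

lemma integral_sq_aux (m : ℝ) (v : ℝ≥0) :
    Integrable (fun x => (x - m) ^ 2) (gaussianReal m v) ∧
    ∫ x, (x - m) ^ 2 ∂(gaussianReal m v) = v := by
  constructor
  · have := (memLp_id_gaussianReal (μ := m) (v := v) 2).sub (memLp_const m)
    exact this.integrable_sq
  · have := variance_fun_id_gaussianReal (μ := m) (v := v)
    rw [variance_eq_integral (by fun_prop)] at this
    simpa using this

lemma density_aux (σ τ s : ℝ≥0) (hσ : σ ≠ 0) (hτ : τ ≠ 0) (k m₁ m₂ : ℝ) :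
    ((gaussianReal 0 τ).prod (gaussianReal 0 s)).map (fun y => (m₁ + (k * y.2 + y.1), m₂ + y.2))
      = ((gaussianReal m₁ σ).prod (gaussianReal m₂ s)).withDensity
        (fun q => gaussianPDF (m₁ + k * (q.2 - m₂)) τ q.1 / gaussianPDF m₁ σ q.1) := by
  have hmeas : Measurable (fun q : ℝ × ℝ =>
      gaussianPDF (m₁ + k * (q.2 - m₂)) τ q.1 / gaussianPDF m₁ σ q.1) := by
    have h0 := measurable_uncurry_gaussianPDF
    have h1 : Measurable (fun q : ℝ × ℝ => gaussianPDF (m₁ + k * (q.2 - m₂)) τ q.1) :=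
      h0.comp (g := fun p : ℝ × ℝ≥0 × ℝ => gaussianPDF p.1 p.2.1 p.2.2)
        (f := fun q : ℝ × ℝ => (m₁ + k * (q.2 - m₂), τ, q.1)) (by fun_prop)
    exact h1.div ((measurable_gaussianPDF _ _).comp measurable_fst)
  have key : ∀ m, gaussianReal m τ = (gaussianReal m₁ σ).withDensity
      (fun x => gaussianPDF m τ x / gaussianPDF m₁ σ x) := by
    intro m
    change _ = (gaussianReal m₁ σ).withDensity (gaussianPDF m τ / gaussianPDF m₁ σ)
    rw [gaussianReal_of_var_ne_zero _ hσ, gaussianReal_of_var_ne_zero _ hτ,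
      ← withDensity_mul _ (measurable_gaussianPDF _ _)
        ((measurable_gaussianPDF _ _).div (measurable_gaussianPDF _ _))]
    congr 1
    ext x
    rw [Pi.mul_apply, Pi.div_apply, ENNReal.mul_div_cancel (gaussianPDF_pos _ hσ x).ne' gaussianPDF_ne_top]
  ext S hS
  rw [Measure.map_apply (by fun_prop) hS, withDensity_apply _ hS,
    Measure.prod_apply_symm (hS.preimage (by fun_prop)), ← lintegral_indicator hS,
    lintegral_prod_symm' _ (hmeas.indicator hS)]
  have hs : gaussianReal m₂ s = (gaussianReal 0 s).map (fun x => m₂ + x) := by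
    rw [gaussianReal_map_const_add]; simp
  rw [hs, lintegral_map (hmeas.indicator hS).lintegral_prod_left' (by fun_prop)]
  congr 1
  ext u
  have hSu : MeasurableSet ((fun x : ℝ => (x, m₂ + u)) ⁻¹' S) := hS.preimage (by fun_prop)
  have : gaussianReal (m₁ + k * u) τ = (gaussianReal 0 τ).map (fun x => (m₁ + k * u) + x) := by
    rw [gaussianReal_map_const_add]; simp
  have e := congrArg (fun ρ : Measure ℝ => ρ ((fun x : ℝ => (x, m₂ + u)) ⁻¹' S))
    (this.symm.trans (key (m₁ + k * u)))
  rw [Measure.map_apply (by fun_prop) hSu, withDensity_apply _ hSu, ← lintegral_indicator hSu] at e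
  convert e using 2
  · ext x; simp [add_assoc]
  · ext x
    simp [Set.indicator]
    rfl

lemma kl_aux (σ τ s : ℝ≥0) (hσ : σ ≠ 0) (hτ : τ ≠ 0) (k m₁ m₂ : ℝ)
    (h : (σ : ℝ) = k ^ 2 * s + τ) (J : Measure (ℝ × ℝ))
    (hJ : J = ((gaussianReal 0 τ).prod (gaussianReal 0 s)).map
      (fun y => (m₁ + (k * y.2 + y.1), m₂ + y.2))) :
    ∫ q, Real.log ((J.rnDeriv ((gaussianReal m₁ σ).prod (gaussianReal m₂ s)) q).toReal) ∂J
      = 1 / 2 * Real.log (σ / τ) := by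
  have hd := density_aux σ τ s hσ hτ k m₁ m₂
  rw [← hJ] at hd
  have hmeas : Measurable (fun q : ℝ × ℝ =>
      gaussianPDF (m₁ + k * (q.2 - m₂)) τ q.1 / gaussianPDF m₁ σ q.1) := by
    have h0 := measurable_uncurry_gaussianPDF
    have h1 : Measurable (fun q : ℝ × ℝ => gaussianPDF (m₁ + k * (q.2 - m₂)) τ q.1) :=
      h0.comp (g := fun p : ℝ × ℝ≥0 × ℝ => gaussianPDF p.1 p.2.1 p.2.2)
        (f := fun q : ℝ × ℝ => (m₁ + k * (q.2 - m₂), τ, q.1)) (by fun_prop)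
    exact h1.div ((measurable_gaussianPDF _ _).comp measurable_fst)
  have hac : J ≪ (gaussianReal m₁ σ).prod (gaussianReal m₂ s) := by
    rw [hd]; exact withDensity_absolutelyContinuous _ _
  have hrn := Measure.rnDeriv_withDensity ((gaussianReal m₁ σ).prod (gaussianReal m₂ s)) hmeas
  rw [← hd] at hrn
  have hσ0 : (0:ℝ) < σ := by positivity
  have hτ0 : (0:ℝ) < τ := by positivity
  have hlog : ∀ q : ℝ × ℝ, Real.log
      (gaussianPDF (m₁ + k * (q.2 - m₂)) τ q.1 / gaussianPDF m₁ σ q.1).toReal =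
      1 / 2 * Real.log (σ / τ) + ((q.1 - m₁) ^ 2 / (2 * σ)
        - (q.1 - (m₁ + k * (q.2 - m₂))) ^ 2 / (2 * τ)) := by
    intro q
    rw [ENNReal.toReal_div, toReal_gaussianPDF, toReal_gaussianPDF,
      Real.log_div (gaussianPDFReal_pos _ _ _ hτ).ne' (gaussianPDFReal_pos _ _ _ hσ).ne',
      gaussianPDFReal_def, gaussianPDFReal_def]
    simp only
    have hpi := Real.pi_pos
    rw [Real.log_mul (by positivity) (by positivity), Real.log_mul (by positivity) (by positivity),
      Real.log_inv, Real.log_inv, Real.log_sqrt (by positivity), Real.log_sqrt (by positivity),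
      Real.log_mul (y := (τ:ℝ)) (by positivity) (by positivity),
      Real.log_mul (y := (σ:ℝ)) (by positivity) (by positivity),
      Real.log_exp, Real.log_exp, Real.log_div (by positivity) (by positivity)]
    ring
  have hJp : IsProbabilityMeasure J := by
    rw [hJ]; exact Measure.isProbabilityMeasure_map (by fun_prop)
  have hg1 : J.map (fun q => q.1) = gaussianReal m₁ σ := by
    rw [hJ, Measure.map_map (by fun_prop) (by fun_prop)]
    exact marginal_aux σ τ s k m₁ h
  have hg2 : J.map (fun q => q.1 - (m₁ + k * (q.2 - m₂))) = gaussianReal 0 τ := by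
    rw [hJ, Measure.map_map (by fun_prop) (by fun_prop)]
    have : ((fun q : ℝ × ℝ => q.1 - (m₁ + k * (q.2 - m₂))) ∘
      fun y : ℝ × ℝ => (m₁ + (k * y.2 + y.1), m₂ + y.2)) = Prod.fst := by
      ext y; simp
    rw [this, Measure.map_fst_prod]; simp
  have i1 := integral_sq_aux m₁ σ
  rw [← hg1, integrable_map_measure (by fun_prop) (by fun_prop),
    integral_map (by fun_prop) (by fun_prop)] at i1
  have i2 := integral_sq_aux 0 τ
  rw [← hg2, integrable_map_measure (by fun_prop) (by fun_prop),
    integral_map (by fun_prop) (by fun_prop)] at i2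
  simp only [Function.comp_def, sub_zero] at i1 i2
  calc _ = ∫ q, (1 / 2 * Real.log (σ / τ) + ((q.1 - m₁) ^ 2 / (2 * σ)
        - (q.1 - (m₁ + k * (q.2 - m₂))) ^ 2 / (2 * τ))) ∂J := by
        apply integral_congr_ae
        filter_upwards [hac.ae_le hrn] with q hq
        rw [hq, hlog]
    _ = _ := by
        have i3 : Integrable (fun q : ℝ × ℝ => (q.1 - m₁) ^ 2 / (2 * σ)
          - (q.1 - (m₁ + k * (q.2 - m₂))) ^ 2 / (2 * τ)) J :=
          (i1.1.div_const _).sub (i2.1.div_const _)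
        rw [integral_add (integrable_const _) i3, integral_sub (i1.1.div_const _) (i2.1.div_const _), integral_div, integral_div,
          i1.2, i2.2]
        simp
        field_simp
        ring

/-- For `0 < η ≤ ρ < 1`, `b = √((ρ²−η²)/(1+η²ρ²−2η²))` and the centered Gaussian vector
`(Z, X, V)` with unit variances, `E[XZ]=η`, `E[XV]=b`, `E[ZV]=ηb`:
`I(X; V | Z) = (1/2)·log((1−η²)/(1−ρ²))`. -/
theorem gaussian_condMutualInfo
    {Ω : Type*} [MeasurableSpace Ω] [StandardBorelSpace Ω]
    (μ : Measure Ω) [IsProbabilityMeasure μ]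
    (Z X V : Ω → ℝ) (hZ : Measurable Z) (hX : Measurable X) (hV : Measurable V)
    (η ρ b : ℝ) (hη : 0 < η) (hηρ : η ≤ ρ) (hρ : ρ < 1)
    (hbdef : b = Real.sqrt ((ρ ^ 2 - η ^ 2) / (1 + η ^ 2 * ρ ^ 2 - 2 * η ^ 2)))
    (hG : IsCenteredGaussianTriple μ Z X V η b) :
    condMutualInfo μ X V Z = (1 / 2) * Real.log ((1 - η ^ 2) / (1 - ρ ^ 2)) := by
  have hη1 : η ^ 2 < 1 := by nlinarith
  have hρ1 : ρ ^ 2 < 1 := by nlinarith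
  have hηρ2 : η ^ 2 ≤ ρ ^ 2 := by nlinarith
  have hD : 0 < 1 + η ^ 2 * ρ ^ 2 - 2 * η ^ 2 := by
    nlinarith [mul_nonneg (sq_nonneg η) (sub_nonneg.2 hηρ2), pow_pos (sub_pos.2 hη1) 2]
  have hb2 : b ^ 2 * (1 + η ^ 2 * ρ ^ 2 - 2 * η ^ 2) = ρ ^ 2 - η ^ 2 := by
    rw [hbdef, Real.sq_sqrt (div_nonneg (by linarith) hD.le), div_mul_cancel₀ _ hD.ne']
  have hsD : (1 - η ^ 2 * b ^ 2) * (1 + η ^ 2 * ρ ^ 2 - 2 * η ^ 2) = (1 - η ^ 2) ^ 2 := by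
    linear_combination (-η ^ 2) * hb2
  have hs0 : 0 < 1 - η ^ 2 * b ^ 2 := by
    have : 0 < (1 - η ^ 2) ^ 2 := pow_pos (sub_pos.2 hη1) 2
    rw [← hsD] at this
    exact pos_of_mul_pos_left this hD.le
  obtain ⟨σ, hσ⟩ : ∃ σ : ℝ≥0, (σ : ℝ) = 1 - η ^ 2 := ⟨⟨1 - η ^ 2, by linarith⟩, rfl⟩
  obtain ⟨τ, hτ⟩ : ∃ τ : ℝ≥0, (τ : ℝ) = 1 - ρ ^ 2 := ⟨⟨1 - ρ ^ 2, by linarith⟩, rfl⟩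
  obtain ⟨s, hs⟩ : ∃ s : ℝ≥0, (s : ℝ) = 1 - η ^ 2 * b ^ 2 := ⟨⟨_, hs0.le⟩, rfl⟩
  have hσ0 : σ ≠ 0 := by rintro rfl; simp at hσ; linarith
  have hτ0 : τ ≠ 0 := by rintro rfl; simp at hτ; linarith
  obtain ⟨k, hk⟩ : ∃ k : ℝ, k * (1 - η ^ 2 * b ^ 2) = b * (1 - η ^ 2) :=
    ⟨b * (1 - η ^ 2) / (1 - η ^ 2 * b ^ 2), div_mul_cancel₀ _ hs0.ne'⟩
  have h2 : (1 - η ^ 2) = k ^ 2 * (1 - η ^ 2 * b ^ 2) + (1 - ρ ^ 2) := by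
    have h3 : (ρ ^ 2 - η ^ 2) * (1 - η ^ 2 * b ^ 2) = b ^ 2 * (1 - η ^ 2) ^ 2 := by
      rw [← hb2, mul_assoc, mul_comm (1 + _ - _), hsD]
    have h4 : (k ^ 2 * (1 - η ^ 2 * b ^ 2)) * (1 - η ^ 2 * b ^ 2)
        = (ρ ^ 2 - η ^ 2) * (1 - η ^ 2 * b ^ 2) := by
      rw [h3]
      linear_combination (k * (1 - η ^ 2 * b ^ 2) + b * (1 - η ^ 2)) * hk
    have := mul_right_cancel₀ hs0.ne' h4
    linarith
  have h2' : (σ : ℝ) = k ^ 2 * s + τ := by rw [hσ, hs, hτ]; exact h2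
  set U : Ω → ℝ := fun ω => V ω - η * b * Z ω with hU
  set W : Ω → ℝ := fun ω => X ω - η * Z ω - k * U ω with hW
  have hUm : Measurable U := by fun_prop
  have hWm : Measurable W := by fun_prop
  have hlaw := triple_law μ Z W U hZ hWm hUm 1 τ s (by
    intro a c e
    have := hG (a - c * η + c * k * (η * b) - e * (η * b)) c (e - c * k)
    convert this using 2
    · ext ω; simp only [hW, hU]; ring
    · rw [hτ, hs]
      congr 1
      push_cast
      linear_combination (2 * c * e - 2 * c ^ 2 * k) * hk - c ^ 2 * h2)
  have hZlaw : μ.map Z = gaussianReal 0 1 := by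
    have := hG 1 0 0
    simpa using this
  rw [← hZlaw] at hlaw
  have hJ := condDistrib_indep_aux μ Z (fun ω => (W ω, U ω)) hZ (by fun_prop) _ hlaw
    (fun p => (η * p.1 + (k * p.2.2 + p.2.1), η * b * p.1 + p.2.2)) (by fun_prop)
    (fun ω => (X ω, V ω)) (by ext ω <;> simp [hW, hU])
  have hXc := condDistrib_indep_aux μ Z (fun ω => (W ω, U ω)) hZ (by fun_prop) _ hlaw
    (fun p => η * p.1 + (k * p.2.2 + p.2.1)) (by fun_prop) X (by ext ω; simp [hW, hU])
  have hVc := condDistrib_indep_aux μ Z (fun ω => (W ω, U ω)) hZ (by fun_prop) _ hlaw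
    (fun p => η * b * p.1 + p.2.2) (by fun_prop) V (by ext ω; simp [hU])
  have hp : IsProbabilityMeasure (μ.map Z) := Measure.isProbabilityMeasure_map hZ.aemeasurable
  rw [condMutualInfo]
  have : ∀ᵐ z ∂(μ.map Z), ∫ q, Real.log
      (((condDistrib (fun ω => (X ω, V ω)) Z μ z).rnDeriv
          ((condDistrib X Z μ z).prod (condDistrib V Z μ z)) q).toReal)
    ∂(condDistrib (fun ω => (X ω, V ω)) Z μ z) =
      (1 / 2) * Real.log ((1 - η ^ 2) / (1 - ρ ^ 2)) := by
    filter_upwards [hJ, hXc, hVc] with z h1 h3 h4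
    have h3' : condDistrib X Z μ z = gaussianReal (η * z) σ := by
      rw [h3]; exact marginal_aux σ τ s k (η * z) h2'
    have h4' : condDistrib V Z μ z = gaussianReal (η * b * z) s := by
      rw [h4]
      have : (fun y : ℝ × ℝ => η * b * z + y.2) = (fun x => η * b * z + x) ∘ Prod.snd := rfl
      simp only [this]
      rw [← Measure.map_map (by fun_prop) (by fun_prop), Measure.map_snd_prod]
      simp [gaussianReal_map_const_add]
    rw [h3', h4', kl_aux σ τ s hσ0 hτ0 k (η * z) (η * b * z) h2' _ h1, hσ, hτ]
  rw [integral_congr_ae this]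
  simp
end
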